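/- Let K = ℚ(ξ) be the third cyclotomic field, where ξ is a primitive cube root of unity. Then K is a splitting field for the group SL(2, F₃): for every simple module V over the group algebra K[SL(2, F₃)], every K[SL(2, F₃)]-module endomorphism of V is multiplication by a scalar from K, i.e., End_{K[SL(2,F₃)]}(V) has dimension 1 over K. -/

import Mathlib

universe u

/-- The group algebra `K[SL(2, F₃)]` over the third cyclotomic field `K = ℚ(ξ)`. -/
noncomputable abbrev KSL₂F₃ : Type :=
  MonoidAlgebra (CyclotomicField 3 ℚ) (Matrix.SpecialLinearGroup (Fin 2) (ZMod 3))

theorem sl23_core {K V : Type*} [Field K] [CharZero K] [AddCommGroup V] [Module K V] [Nontrivial V]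
    (ω : K) (hω : ω ^ 2 + ω + 1 = 0) (I J T f : V →ₗ[K] V)
    (hI4 : ∀ v, I (I (I (I v))) = v) (hJ : ∀ v, J (J v) = I (I v))
    (hJI : ∀ v, J (I v) = I (I (I (J v)))) (hT : ∀ v, T (T (T v)) = v)
    (hTI : ∀ v, T (I v) = J (T v)) (hTJ : ∀ v, T (J v) = I (J (T v)))
    (hirr : ∀ W : Submodule K V, (∀ w ∈ W, I w ∈ W) → (∀ w ∈ W, J w ∈ W) → (∀ w ∈ W, T w ∈ W) →
      (∃ w ∈ W, w ≠ 0) → ∀ v, v ∈ W)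
    (fI : ∀ v, f (I v) = I (f v)) (fJ : ∀ v, f (J v) = J (f v)) (fT : ∀ v, f (T v) = T (f v)) :
    ∃ c : K, ∀ v, f v = c • v := by
  have h3 : ω ^ 3 = 1 := by linear_combination (ω - 1) * hω
  -- an eigenvector suffices
  have fin : ∀ (c : K) (w : V), w ≠ 0 → f w = c • w → ∃ c : K, ∀ v, f v = c • v := by
    intro c w hw hfw
    refine ⟨c, fun v => ?_⟩
    have := hirr (LinearMap.ker (f - c • LinearMap.id))
      (by intro w hw
          simp only [LinearMap.mem_ker, LinearMap.sub_apply, LinearMap.smul_apply,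
            LinearMap.id_apply, sub_eq_zero] at hw ⊢
          rw [fI, hw, map_smul])
      (by intro w hw
          simp only [LinearMap.mem_ker, LinearMap.sub_apply, LinearMap.smul_apply,
            LinearMap.id_apply, sub_eq_zero] at hw ⊢
          rw [fJ, hw, map_smul])
      (by intro w hw
          simp only [LinearMap.mem_ker, LinearMap.sub_apply, LinearMap.smul_apply,
            LinearMap.id_apply, sub_eq_zero] at hw ⊢
          rw [fT, hw, map_smul])
      ⟨w, by simp [hfw], hw⟩ v
    simpa [sub_eq_zero] using this
  -- projections onto eigenspaces of `T`
  have tproj : ∀ w : V, w ≠ 0 → ∃ χ : K, ∃ u : V, u = w + χ • T w + χ ^ 2 • T (T w) ∧ u ≠ 0 ∧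
      T u = χ ^ 2 • u := by
    intro w hw
    have key : ∀ χ : K, χ ^ 3 = 1 → T (w + χ • T w + χ ^ 2 • T (T w)) =
        χ ^ 2 • (w + χ • T w + χ ^ 2 • T (T w)) := by
      intro χ hχ
      simp only [map_add, map_smul, hT, smul_add, smul_smul]
      have e1 : χ ^ 2 * χ = 1 := by linear_combination hχ
      have e2 : χ ^ 2 * χ ^ 2 = χ := by linear_combination χ * hχ
      rw [e1, e2]; module
    by_contra hcon
    push Not at hcon
    have z : ∀ χ : K, χ ^ 3 = 1 → w + χ • T w + χ ^ 2 • T (T w) = 0 := by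
      intro χ hχ
      by_contra hne
      exact hcon χ _ rfl hne (key χ hχ)
    have z1 := z 1 (by norm_num)
    have z2 := z ω h3
    have z3 := z (ω ^ 2) (by linear_combination (ω ^ 3 + 1) * h3)
    have e4 : (ω ^ 2) ^ 2 = ω := by linear_combination ω * h3
    have e5 : ω ^ 2 = -1 - ω := by linear_combination hω
    rw [e4, e5] at z3
    rw [e5] at z2
    apply hw
    have : (3 : K) • w = 0 := by
      linear_combination (norm := module) z1 + z2 + z3
    exact (smul_eq_zero.mp this).resolve_left (by norm_num)
  by_cases hz : ∃ v, v + I (I v) ≠ 0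
  · obtain ⟨v0, hv0⟩ := hz
    obtain ⟨v, hv, hzv⟩ : ∃ v, v ≠ 0 ∧ I (I v) = v :=
      ⟨_, hv0, by simp only [map_add, hI4]; abel⟩
    -- `V₄`-projections
    have vproj : ∀ a b : K, a ^ 2 = 1 → b ^ 2 = 1 →
        ∀ w, w = v + a • I v + b • J v + (a * b) • I (J v) →
        I w = a • w ∧ J w = b • w := by
      intro a b ha hb w hw
      have hzJ : I (I (J v)) = J v := by rw [← hJ (J v), hJ v, hzv]
      have hJJ : J (J v) = v := by rw [hJ, hzv]
      have hJIv : J (I v) = I (J v) := by rw [hJI, ← hzJ, hI4, hzJ]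
      have hJIJ : J (I (J v)) = I v := by rw [hJI, hJJ, hzv]
      have e1 : a * (a * b) = b := by linear_combination b * ha
      have e2 : b * (a * b) = a := by linear_combination a * hb
      have e3 : a * a = 1 := by linear_combination ha
      have e4 : b * b = 1 := by linear_combination hb
      subst hw
      simp only [map_add, map_smul, smul_add, smul_smul, hzv, hzJ, hJJ, hJIv, hJIJ, e1, e2, e3, e4]
      constructor <;> module
    have nontriv : ∀ a b : K, a ^ 2 = 1 → b ^ 2 = 1 → ¬ (a = 1 ∧ b = 1) →
        ∀ w, w ≠ 0 → I w = a • w → J w = b • w → ∃ c : K, ∀ v, f v = c • v := by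
      intro a b ha hb hab w hw hIw hJw
      have iT : ∀ x, I (T x) = T (I (J x)) := by
        intro x
        rw [hTI, hTJ, hJI, hJ, hI4 (I (T x))]
      have jT : ∀ x, J (T x) = T (I x) := fun x => (hTI x).symm
      have i1 : I (T w) = (a * b) • T w := by
        rw [iT, hJw, map_smul, map_smul, hIw, map_smul, smul_smul, mul_comm]
      have j1 : J (T w) = a • T w := by rw [jT, hIw, map_smul]
      have i2 : I (T (T w)) = b • T (T w) := by
        rw [iT, j1, map_smul, map_smul, i1, map_smul, smul_smul]
        congr 1; linear_combination b * ha
      have j2 : J (T (T w)) = (a * b) • T (T w) := by rw [jT, i1, map_smul]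
      have mem := hirr (Submodule.span K {w, T w, T (T w)})
      have hspan : ∀ x, x ∈ Submodule.span K {w, T w, T (T w)} ↔
          ∃ p q r : K, p • w + q • T w + r • T (T w) = x := by
        intro x; rw [Submodule.mem_span_triple]
      simp only [hspan] at mem
      obtain ⟨p, q, r, hf⟩ := mem
        (by rintro _ ⟨p, q, r, rfl⟩
            refine ⟨p * a, q * (a * b), r * b, ?_⟩
            simp only [map_add, map_smul, hIw, i1, i2, smul_smul])
        (by rintro _ ⟨p, q, r, rfl⟩
            refine ⟨p * b, q * a, r * (a * b), ?_⟩
            simp only [map_add, map_smul, hJw, j1, j2, smul_smul])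
        (by rintro _ ⟨p, q, r, rfl⟩
            refine ⟨r, p, q, ?_⟩
            simp only [map_add, map_smul, hT]; abel)
        ⟨w, ⟨1, 0, 0, by simp⟩, hw⟩ (f w)
      have hI := fI w
      have hJ' := fJ w
      rw [hIw, map_smul, ← hf] at hI
      rw [hJw, map_smul, ← hf] at hJ'
      simp only [map_add, map_smul, hIw, i1, i2] at hI
      simp only [map_add, map_smul, hJw, j1, j2] at hJ'
      refine fin p w hw ?_
      rw [← hf]
      have ha' : a = 1 ∨ a = -1 := by simpa using ha
      have hb' : b = 1 ∨ b = -1 := by simpa using hb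
      have two : ∀ x : V, (2 : K) • x = 0 → x = 0 := fun x hx =>
        (smul_eq_zero.mp hx).resolve_left (by norm_num)
      rw [← sub_eq_zero]
      apply two
      rcases ha' with rfl | rfl <;> rcases hb' with rfl | rfl
      · exact absurd ⟨rfl, rfl⟩ hab
      · linear_combination (norm := module) hI
      · linear_combination (norm := module) hJ'
      · linear_combination (norm := module) (-1 : K) • hI - hJ'
    by_cases hn : ∃ a b : K, a ^ 2 = 1 ∧ b ^ 2 = 1 ∧ ¬ (a = 1 ∧ b = 1) ∧
        v + a • I v + b • J v + (a * b) • I (J v) ≠ 0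
    · obtain ⟨a, b, ha, hb, hab, hne⟩ := hn
      obtain ⟨h1, h2⟩ := vproj a b ha hb _ rfl
      exact nontriv a b ha hb hab _ hne h1 h2
    · push Not at hn
      have n1 : (1 : K) ≠ -1 := by norm_num
      have n2 : (-1 : K) ≠ 1 := by norm_num
      have q1 := hn 1 (-1) (by norm_num) (by norm_num) (by simp [n2])
      have q2 := hn (-1) 1 (by norm_num) (by norm_num) (by simp [n2])
      have q3 := hn (-1) (-1) (by norm_num) (by norm_num) (by simp [n2])
      obtain ⟨h1, h2⟩ := vproj 1 1 (by norm_num) (by norm_num) _ rfl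
      have h4 : v + (1 : K) • I v + (1 : K) • J v + ((1 : K) * 1) • I (J v) = (4 : K) • v := by
        linear_combination (norm := module) (-1 : K) • q1 - q2 - q3
      rw [h4, map_smul, one_smul] at h1 h2
      have four : (4 : K) ≠ 0 := by norm_num
      have hIv : I v = v := smul_right_injective V four h1
      have hJv : J v = v := smul_right_injective V four h2
      have iT : ∀ x, I (T x) = T (I (J x)) := by
        intro x
        rw [hTI, hTJ, hJI, hJ, hI4 (I (T x))]
      have jT : ∀ x, J (T x) = T (I x) := fun x => (hTI x).symm
      obtain ⟨χ, u, hu, hu0, hTu⟩ := tproj v hv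
      have hIu : I u = u := by
        rw [hu]; simp only [map_add, map_smul, iT, jT, hIv, hJv]
      have hJu : J u = u := by
        rw [hu]; simp only [map_add, map_smul, iT, jT, hIv, hJv]
      obtain ⟨c, hc⟩ := Submodule.mem_span_singleton.mp (hirr (Submodule.span K {u})
        (by intro x hx
            obtain ⟨c, rfl⟩ := Submodule.mem_span_singleton.mp hx
            rw [map_smul, hIu]; exact hx)
        (by intro x hx
            obtain ⟨c, rfl⟩ := Submodule.mem_span_singleton.mp hx
            rw [map_smul, hJu]; exact hx)
        (by intro x hx
            obtain ⟨c, rfl⟩ := Submodule.mem_span_singleton.mp hx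
            rw [map_smul, hTu]
            exact Submodule.smul_mem _ _ (Submodule.smul_mem _ _
              (Submodule.mem_span_singleton_self u)))
        ⟨u, Submodule.mem_span_singleton_self u, hu0⟩ (f u))
      exact fin c u hu0 hc.symm
  · push Not at hz
    have hII : ∀ v, I (I v) = -v := fun v => eq_neg_of_add_eq_zero_right (hz v)
    have hJJ : ∀ v, J (J v) = -v := fun v => by rw [hJ, hII]
    have hJI' : ∀ v, J (I v) = - I (J v) := fun v => by rw [hJI, hII]
    have e5 : ω ^ 2 = -1 - ω := by linear_combination hω
    -- kernel of the nilpotent `s = i + ω j + ω² k`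
    obtain ⟨w, hw, hsw⟩ : ∃ w, w ≠ 0 ∧ I w + ω • J w + (-1 - ω) • I (J w) = 0 := by
      obtain ⟨v, hv⟩ := exists_ne (0 : V)
      by_cases h : I v + ω • J v + (-1 - ω) • I (J v) = 0
      · exact ⟨v, hv, h⟩
      · refine ⟨_, h, ?_⟩
        simp only [map_add, map_smul, map_neg, hII, hJJ, hJI', smul_neg]
        linear_combination (norm := module) (-2 : K) • (congrArg (fun x : K => x • v) hω)
    obtain ⟨χ, u, hu, hu0, hTu⟩ := tproj w hw
    have sT : ∀ x, I x + ω • J x + (-1 - ω) • I (J x) = 0 →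
        I (T x) + ω • J (T x) + (-1 - ω) • I (J (T x)) = 0 := by
      intro x hx
      have := congrArg T hx
      simp only [map_add, map_smul, map_zero, hTI, hTJ, hJI', hJJ, map_neg, neg_neg] at this
      have h6 := congrArg (fun y => ω • y) this
      simp only [smul_add, smul_smul, smul_zero] at h6
      have e6 : ω * ω = -1 - ω := by linear_combination hω
      have e7 : ω * (-1 - ω) = 1 := by linear_combination -hω
      rw [e6, e7] at h6
      linear_combination (norm := module) h6
    have hsu : I u + ω • J u + (-1 - ω) • I (J u) = 0 := by
      have s1 := sT _ hsw
      have s2 := sT _ s1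
      rw [hu]; simp only [map_add, map_smul]
      linear_combination (norm := module) hsw + χ • s1 + χ ^ 2 • s2
    have hisu := congrArg I hsu
    simp only [map_add, map_smul, map_zero, hII] at hisu
    have hJu : J u = ω • I u + (-1 - ω) • u := by
      have hk : ∀ x : V, (ω ^ 2 + ω + 1) • x = 0 := fun x => by rw [hω, zero_smul]
      linear_combination (norm := module) (-ω) • hsu + (ω ^ 2) • hisu - (ω - 1) • hk (J u) +
        hk u - ω • hk (I (J u))
    have hTIu : T (I u) = χ ^ 2 • (ω • I u + (-1 - ω) • u) := by
      rw [hTI, hTu, map_smul, hJu]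
    obtain ⟨a, b, hf⟩ := Submodule.mem_span_pair.mp (hirr (Submodule.span K {u, I u})
      (by intro x hx
          obtain ⟨a, b, rfl⟩ := Submodule.mem_span_pair.mp hx
          refine Submodule.mem_span_pair.mpr ⟨-b, a, ?_⟩
          simp only [map_add, map_smul, hII]; module)
      (by intro x hx
          obtain ⟨a, b, rfl⟩ := Submodule.mem_span_pair.mp hx
          refine Submodule.mem_span_pair.mpr ⟨a * (-1 - ω) + b * ω, a * ω - b * (-1 - ω), ?_⟩
          simp only [map_add, map_smul, hII, hJu, hJI']; module)
      (by intro x hx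
          obtain ⟨a, b, rfl⟩ := Submodule.mem_span_pair.mp hx
          refine Submodule.mem_span_pair.mpr
            ⟨a * χ ^ 2 + b * χ ^ 2 * (-1 - ω), b * χ ^ 2 * ω, ?_⟩
          simp only [map_add, map_smul, hTu, hTIu]; module)
      ⟨u, Submodule.mem_span_pair.mpr ⟨1, 0, by simp⟩, hu0⟩ (f u))
    have hfs := congrArg f hsu
    simp only [map_add, map_smul, map_zero, fI, fJ, ← hf, hII, hJI', map_neg] at hfs
    have hb : b • ((2 : K) • u) = 0 := by
      linear_combination (norm := module) a • hsu - b • hisu - hfs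
    have hb0 : b = 0 := by
      simpa [smul_eq_zero, hu0] using hb
    exact fin a u hu0 (by rw [← hf, hb0]; simp)

theorem exists_omega : ∃ ω : CyclotomicField 3 ℚ, ω ^ 2 + ω + 1 = 0 := by
  have : NeZero ((3 : ℕ) : ℚ) := ⟨by norm_num⟩
  have := CyclotomicField.isCyclotomicExtension 3 ℚ
  obtain ⟨ω, hz⟩ := this.exists_isPrimitiveRoot (Set.mem_singleton 3) (by norm_num)
  refine ⟨ω, ?_⟩
  have h := hz.geom_sum_eq_zero (by norm_num)
  simp only [Finset.sum_range_succ, Finset.sum_range_zero] at h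
  linear_combination h

abbrev SL23 := Matrix.SpecialLinearGroup (Fin 2) (ZMod 3)

def gi : SL23 := ⟨!![0, -1; 1, 0], by decide⟩

def gj : SL23 := ⟨!![1, 1; 1, 2], by decide⟩

def gt : SL23 := ⟨!![1, 1; 0, 1], by decide⟩

theorem sl23_gen_entries : ∀ a b c d : ZMod 3, a * d - b * c = 1 →
    ∃ (x : Fin 4) (y : Fin 2) (z : Fin 3),
      (gi ^ (x : ℕ) * gj ^ (y : ℕ) * gt ^ (z : ℕ)).1 0 0 = a ∧
      (gi ^ (x : ℕ) * gj ^ (y : ℕ) * gt ^ (z : ℕ)).1 0 1 = b ∧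
      (gi ^ (x : ℕ) * gj ^ (y : ℕ) * gt ^ (z : ℕ)).1 1 0 = c ∧
      (gi ^ (x : ℕ) * gj ^ (y : ℕ) * gt ^ (z : ℕ)).1 1 1 = d := by
  decide +kernel

theorem sl23_gen (g : SL23) : ∃ x y z : ℕ, g = gi ^ x * gj ^ y * gt ^ z := by
  have hdet := g.2
  rw [Matrix.det_fin_two] at hdet
  obtain ⟨x, y, z, h1, h2, h3, h4⟩ := sl23_gen_entries _ _ _ _ hdet
  refine ⟨x, y, z, ?_⟩
  ext i j
  fin_cases i <;> fin_cases j
  · exact h1.symm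
  · exact h2.symm
  · exact h3.symm
  · exact h4.symm

/-- `ℚ(ξ)`, `ξ` a primitive cube root of unity, is a splitting field for `SL(2, F₃)`:
every endomorphism of a simple `K[SL(2,F₃)]`-module is multiplication by a scalar from `K`. -/
theorem stmt16 :
    ∀ (V : Type u) [AddCommGroup V] [Module KSL₂F₃ V], IsSimpleModule KSL₂F₃ V →
      ∀ f : Module.End KSL₂F₃ V, ∃ c : CyclotomicField 3 ℚ,
        ∀ v : V, f v = (algebraMap (CyclotomicField 3 ℚ) KSL₂F₃ c) • v := by
  intro V _ _ hV f
  let _ : Module (CyclotomicField 3 ℚ) V :=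
    Module.compHom V (algebraMap (CyclotomicField 3 ℚ) KSL₂F₃)
  have hsm : ∀ (c : CyclotomicField 3 ℚ) (v : V),
      c • v = (algebraMap (CyclotomicField 3 ℚ) KSL₂F₃ c) • v := fun _ _ => rfl
  have : IsScalarTower (CyclotomicField 3 ℚ) KSL₂F₃ V :=
    ⟨fun c a v => by rw [hsm, Algebra.smul_def, mul_smul]⟩
  have : Nontrivial V := IsSimpleModule.nontrivial KSL₂F₃ V
  obtain ⟨ω, hω⟩ := exists_omega
  let L : SL23 → V →ₗ[CyclotomicField 3 ℚ] V := fun g =>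
    Algebra.lsmul (CyclotomicField 3 ℚ) (CyclotomicField 3 ℚ) V
      (MonoidAlgebra.of (CyclotomicField 3 ℚ) SL23 g : KSL₂F₃)
  have hL : ∀ g v, L g v = (MonoidAlgebra.of (CyclotomicField 3 ℚ) SL23 g : KSL₂F₃) • v :=
    fun _ _ => rfl
  have hmul : ∀ g h v, L g (L h v) = L (g * h) v := fun g h v => by
    rw [hL, hL, hL, map_mul, mul_smul]
  have hone : ∀ v, L 1 v = v := fun v => by rw [hL, map_one, one_smul]
  have hfL : ∀ g v, f (L g v) = L g (f v) := fun g v => by rw [hL, hL, map_smul]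
  let f' : V →ₗ[CyclotomicField 3 ℚ] V := f.restrictScalars (CyclotomicField 3 ℚ)
  refine sl23_core ω hω (L gi) (L gj) (L gt) f' ?_ ?_ ?_ ?_ ?_ ?_ ?_
    (hfL gi) (hfL gj) (hfL gt)
  · intro v
    rw [hmul, hmul, hmul, show gi * gi * gi * gi = 1 by decide +kernel, hone]
  · intro v
    rw [hmul, hmul, show gj * gj = gi * gi by decide +kernel]
  · intro v
    rw [hmul, hmul, hmul, hmul, show gj * gi = gi * gi * gi * gj by decide +kernel]
  · intro v
    rw [hmul, hmul, show gt * gt * gt = 1 by decide +kernel, hone]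
  · intro v
    rw [hmul, hmul, show gt * gi = gj * gt by decide +kernel]
  · intro v
    rw [hmul, hmul, hmul, show gt * gj = gi * gj * gt by decide +kernel]
  · intro W hI hJ hT hne v
    have hpow : ∀ g, (∀ w ∈ W, L g w ∈ W) → ∀ n : ℕ, ∀ w ∈ W, L (g ^ n) w ∈ W := by
      intro g hg n
      induction n with
      | zero => intro w hw; rw [pow_zero, hone]; exact hw
      | succ n ih => intro w hw; rw [pow_succ, ← hmul]; exact ih _ (hg w hw)
    have hG : ∀ g, ∀ w ∈ W, L g w ∈ W := by
      intro g w hw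
      obtain ⟨x, y, z, rfl⟩ := sl23_gen g
      rw [← hmul, ← hmul]
      exact hpow _ hI _ _ (hpow _ hJ _ _ (hpow _ hT _ _ hw))
    let N : Submodule KSL₂F₃ V :=
      { carrier := W
        add_mem' := fun ha hb => W.add_mem ha hb
        zero_mem' := W.zero_mem
        smul_mem' := by
          intro a w hw
          induction a using MonoidAlgebra.induction_on with
          | of g => exact hG g w hw
          | add a b ha hb => rw [add_smul]; exact W.add_mem ha hb
          | smul c a ha => rw [smul_assoc]; exact W.smul_mem c ha }
    rcases eq_bot_or_eq_top N with h | h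
    · obtain ⟨w, hw, hw0⟩ := hne
      have : w ∈ N := hw
      rw [h, Submodule.mem_bot] at this
      exact absurd this hw0
    · have : v ∈ N := by rw [h]; trivial
      exact this
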